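/- Every real symmetric positive definite 2N×2N matrix A admits a Williamson normal form: there exist a matrix S in Sp(2N,ℝ) and positive real numbers a₁, …, a_N such that S A Sᵀ = diag(a₁, a₁, a₂, a₂, …, a_N, a_N). -/

import Mathlib

open Matrix Polynomial
open ComplexOrder

noncomputable section

/-- The standard symplectic form matrix: block diagonal with 2×2 blocks [[0,1],[-1,0]]. -/
def symplForm (n : ℕ) : Matrix (Fin n) (Fin n) ℝ :=
  Matrix.of fun i j =>
    if (i : ℕ) + 1 = (j : ℕ) ∧ (i : ℕ) % 2 = 0 then 1
    else if (j : ℕ) + 1 = (i : ℕ) ∧ (j : ℕ) % 2 = 0 then -1 else 0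

/-- Membership in the real symplectic group: `S σ Sᵀ = σ`. -/
def IsSymplectic {n : ℕ} (S : Matrix (Fin n) (Fin n) ℝ) : Prop :=
  S * symplForm n * Sᵀ = symplForm n

/-- The Williamson diagonal matrix `diag(a₁,a₁,…,a_N,a_N)`. -/
def WDiag {N : ℕ} (a : Fin N → ℝ) : Matrix (Fin (2 * N)) (Fin (2 * N)) ℝ :=
  Matrix.diagonal fun i => a ⟨(i : ℕ) / 2, by have := i.isLt; omega⟩

/-- A covariance matrix: real symmetric with `γ + iσ` positive semidefinite. -/
def IsCovMatrix {n : ℕ} (γ : Matrix (Fin n) (Fin n) ℝ) : Prop :=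
  γ.IsSymm ∧
    (γ.map (Complex.ofReal) + Complex.I • (symplForm n).map Complex.ofReal).PosSemidef

/-- The block-diagonal direct sum of two square matrices. -/
def dirSum {m n : ℕ} (A : Matrix (Fin m) (Fin m) ℝ) (B : Matrix (Fin n) (Fin n) ℝ) :
    Matrix (Fin (m + n)) (Fin (m + n)) ℝ :=
  Matrix.reindex finSumFinEquiv finSumFinEquiv (Matrix.fromBlocks A 0 0 B)

/-- Separability of a covariance matrix with respect to the split `A|B`. -/
def IsSepCov (nA nB : ℕ) (γ : Matrix (Fin (nA + nB)) (Fin (nA + nB)) ℝ) : Prop :=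
  ∃ (γA : Matrix (Fin nA) (Fin nA) ℝ) (γB : Matrix (Fin nB) (Fin nB) ℝ),
    IsCovMatrix γA ∧ IsCovMatrix γB ∧ (γ - dirSum γA γB).PosSemidef

lemma skew_normal (N : ℕ) : ∀ (E : Type) [NormedAddCommGroup E] [InnerProductSpace ℝ E]
    [FiniteDimensional ℝ E] (T : E →ₗ[ℝ] E), Module.finrank ℝ E = 2 * N →
    (∀ x y, inner ℝ (T x) y = - inner ℝ x (T y)) → (∀ x, T x = 0 → x = 0) →
    ∃ (d : Fin N → ℝ) (e f : Fin N → E), (∀ i, 0 < d i) ∧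
      (∀ i j, inner ℝ (e i) (e j) = if i = j then (1 : ℝ) else 0) ∧
      (∀ i j, inner ℝ (f i) (f j) = if i = j then (1 : ℝ) else 0) ∧
      (∀ i j, inner ℝ (e i) (f j) = (0 : ℝ)) ∧
      (∀ i, T (e i) = - d i • f i) ∧ (∀ i, T (f i) = d i • e i) := by
  induction N with
  | zero =>
    intro E _ _ _ T _ _ _
    exact ⟨Fin.elim0, Fin.elim0, Fin.elim0, fun i => i.elim0, fun i => i.elim0, fun i => i.elim0,
      fun i => i.elim0, fun i => i.elim0, fun i => i.elim0⟩
  | succ N ih =>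
    intro E _ _ _ T hdim hsk hinj
    have hnt : Nontrivial E := Module.nontrivial_of_finrank_pos (R := ℝ) (by omega)
    have hsym : (T ∘ₗ T).IsSymmetric := by
      intro x y
      simp [hsk]
    obtain ⟨c, hc⟩ : ∃ c : ℝ, Module.End.HasEigenvalue (T ∘ₗ T) c := by
      have hpos : 0 < Module.finrank ℝ E := by omega
      exact ⟨_, hsym.hasEigenvalue_eigenvalues rfl ⟨0, hpos⟩⟩
    obtain ⟨v, hv⟩ := hc.exists_hasEigenvector
    have hv0 : v ≠ 0 := hv.2
    have hTv : T (T v) = c • v := hv.apply_eq_smul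
    obtain ⟨e, he, hTe⟩ : ∃ e : E, ‖e‖ = 1 ∧ T (T e) = c • e := by
      refine ⟨(‖v‖)⁻¹ • v, ?_, ?_⟩
      · rw [norm_smul, norm_inv, norm_norm, inv_mul_cancel₀ (norm_ne_zero_iff.2 hv0)]
      · rw [map_smul, map_smul, hTv, smul_comm]
    have hee : inner ℝ e e = (1 : ℝ) := by rw [real_inner_self_eq_norm_sq, he]; norm_num
    have he0 : e ≠ 0 := by rintro rfl; simp at he
    have hTe0 : T e ≠ 0 := fun h => he0 (hinj _ h)
    set δ := ‖T e‖ with hδ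
    have hδ0 : 0 < δ := norm_pos_iff.2 hTe0
    have hcδ : c = - δ ^ 2 := by
      have h1 := hsk (T e) e
      rw [hTe, inner_smul_left, hee, real_inner_self_eq_norm_sq] at h1
      simpa using h1
    have hself : ∀ x, inner ℝ x (T x) = (0 : ℝ) := by
      intro x
      have := hsk x x
      rw [real_inner_comm] at this
      linarith
    obtain ⟨f, hf⟩ : ∃ f, f = (-δ⁻¹) • T e := ⟨_, rfl⟩
    have hTe' : T e = - δ • f := by
      rw [hf, smul_smul]; field_simp; simp
    have hTf : T f = δ • e := by
      rw [hf, map_smul, hTe, hcδ, smul_smul]; congr 1; field_simp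
    have hff : inner ℝ f f = (1 : ℝ) := by
      rw [hf, inner_smul_left, inner_smul_right, real_inner_self_eq_norm_sq, ← hδ]
      simp; field_simp
    have hef : inner ℝ e f = (0 : ℝ) := by
      rw [hf, inner_smul_right, hself, mul_zero]
    have hfe : inner ℝ f e = (0 : ℝ) := by rw [real_inner_comm, hef]
    let U : Submodule ℝ E := Submodule.span ℝ (Set.range ![e, f])
    have hU : ∀ x, x ∈ Uᗮ ↔ inner ℝ e x = (0:ℝ) ∧ inner ℝ f x = (0:ℝ) := by
      intro x
      constructor
      · intro h
        rw [Submodule.mem_orthogonal] at h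
        exact ⟨h e (Submodule.subset_span ⟨0, rfl⟩), h f (Submodule.subset_span ⟨1, rfl⟩)⟩
      · rintro ⟨h1, h2⟩
        rw [Submodule.mem_orthogonal]
        intro u hu
        induction hu using Submodule.span_induction with
        | mem y hy =>
          obtain ⟨i, rfl⟩ := hy
          fin_cases i
          · exact h1
          · exact h2
        | zero => simp
        | add y z _ _ hy hz => rw [inner_add_left, hy, hz, add_zero]
        | smul a y _ hy => rw [inner_smul_left, hy, mul_zero]
    have hinv : ∀ x ∈ Uᗮ, T x ∈ Uᗮ := by
      intro x hx
      rw [hU] at hx ⊢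
      have h1 := hsk e x
      have h2 := hsk f x
      rw [hTe', inner_smul_left, hx.2] at h1
      rw [hTf, inner_smul_left, hx.1] at h2
      constructor <;> linarith
    have hon : Orthonormal ℝ ![e, f] := by
      rw [orthonormal_iff_ite]
      intro i j
      fin_cases i <;> fin_cases j <;> simp [hee, hff, hef, hfe, -inner_self_eq_norm_sq_to_K]
    have hfU : Module.finrank ℝ U = 2 := by
      rw [finrank_span_eq_card hon.linearIndependent]; simp
    have hfU' : Module.finrank ℝ Uᗮ = 2 * N := by
      have := U.finrank_add_finrank_orthogonal
      omega
    obtain ⟨d, e', f', hd, h1, h2, h3, h4, h5⟩ := ih Uᗮ (T.restrict hinv) hfU'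
      (fun x y => hsk x y) (fun x hx => Subtype.ext (hinj _ (congrArg Subtype.val hx)))
    have oe := fun i => ((hU _).1 (e' i).2)
    have of := fun i => ((hU _).1 (f' i).2)
    have oe1 := fun i => (real_inner_comm _ _).trans (oe i).1
    have oe2 := fun i => (real_inner_comm _ _).trans (oe i).2
    have of1 := fun i => (real_inner_comm _ _).trans (of i).1
    have of2 := fun i => (real_inner_comm _ _).trans (of i).2
    refine ⟨Fin.cons δ d, Fin.cons e (fun i => (e' i : E)), Fin.cons f (fun i => (f' i : E)),
      ?_, ?_, ?_, ?_, ?_, ?_⟩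
    · intro i; refine Fin.cases ?_ (fun i => ?_) i
      · exact hδ0
      · exact hd i
    · intro i j
      refine Fin.cases ?_ (fun i => ?_) i <;> refine Fin.cases ?_ (fun j => ?_) j
      · exact hee.trans (if_pos rfl).symm
      · simpa [(Fin.succ_ne_zero j).symm] using (oe j).1
      · simpa using oe1 i
      · simpa using h1 i j
    · intro i j
      refine Fin.cases ?_ (fun i => ?_) i <;> refine Fin.cases ?_ (fun j => ?_) j
      · simpa using hff
      · simpa [(Fin.succ_ne_zero j).symm] using (of j).2
      · simpa using of2 i
      · simpa using h2 i j
    · intro i j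
      refine Fin.cases ?_ (fun i => ?_) i <;> refine Fin.cases ?_ (fun j => ?_) j
      · simpa using hef
      · simpa using (of j).1
      · simpa using oe2 i
      · simpa using h3 i j
    · intro i; refine Fin.cases ?_ (fun i => ?_) i
      · exact hTe'
      · exact congrArg Subtype.val (h4 i)
    · intro i; refine Fin.cases ?_ (fun i => ?_) i
      · exact hTf
      · exact congrArg Subtype.val (h5 i)

open scoped MatrixOrder Matrix.Norms.L2Operator in
lemma posDef_factor {n : ℕ} (A : Matrix (Fin n) (Fin n) ℝ) (hA : A.PosDef) :
    ∃ B : Matrix (Fin n) (Fin n) ℝ, IsUnit B ∧ A = Bᴴ * B := by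
  obtain ⟨B, hB, h⟩ := CStarAlgebra.isStrictlyPositive_iff_eq_star_mul_self.mp
    hA.isStrictlyPositive
  exact ⟨B, hB, h⟩

lemma sympl_transpose (n : ℕ) : (symplForm n)ᵀ = - symplForm n := by
  ext i j
  simp only [symplForm, Matrix.transpose_apply, Matrix.neg_apply, Matrix.of_apply]
  split_ifs <;> first | omega | simp

lemma sympl_inj (N : ℕ) (v : Fin (2 * N) → ℝ) (h : symplForm (2 * N) *ᵥ v = 0) : v = 0 := by
  funext i
  rcases Nat.mod_two_eq_zero_or_one i with hi | hi
  · have hlt : (i : ℕ) + 1 < 2 * N := by omega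
    have h1 := congrFun h ⟨i + 1, hlt⟩
    rw [Matrix.mulVec, dotProduct, Finset.sum_eq_single i] at h1
    · simp only [symplForm, Matrix.of_apply] at h1
      rw [if_neg (by omega), if_pos ⟨trivial, hi⟩] at h1
      simpa using h1
    · intro j _ hj
      have : (j : ℕ) ≠ i := fun h => hj (Fin.ext h)
      simp only [symplForm, Matrix.of_apply]
      rw [if_neg (by omega), if_neg (by omega), zero_mul]
    · simp
  · have hlt : (i : ℕ) - 1 < 2 * N := by omega
    have h1 := congrFun h ⟨i - 1, hlt⟩
    rw [Matrix.mulVec, dotProduct, Finset.sum_eq_single i] at h1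
    · simp only [symplForm, Matrix.of_apply] at h1
      rw [if_pos (by omega)] at h1
      simpa using h1
    · intro j _ hj
      have : (j : ℕ) ≠ i := fun h => hj (Fin.ext h)
      simp only [symplForm, Matrix.of_apply]
      rw [if_neg (by omega), if_neg (by omega), zero_mul]
    · simp

/-- Williamson normal form: every real symmetric positive definite `2N×2N` matrix can be
symplectically diagonalized to `diag(a₁,a₁,…,a_N,a_N)` with `a_i > 0`. -/
theorem williamson_normal_form (N : ℕ) (hN : 1 ≤ N)
    (A : Matrix (Fin (2 * N)) (Fin (2 * N)) ℝ) (hAsymm : A.IsSymm) (hApos : A.PosDef) :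
    ∃ (S : Matrix (Fin (2 * N)) (Fin (2 * N)) ℝ) (a : Fin N → ℝ),
      IsSymplectic S ∧ (∀ i, 0 < a i) ∧ S * A * Sᵀ = WDiag a := by
  obtain ⟨C, hCA, hC⟩ : ∃ C : Matrix (Fin (2 * N)) (Fin (2 * N)) ℝ,
      C * A * Cᵀ = 1 ∧ IsUnit C.det := by
    obtain ⟨B, hB, hBA⟩ : ∃ B : Matrix (Fin (2 * N)) (Fin (2 * N)) ℝ, IsUnit B ∧ A = Bᴴ * B :=
      posDef_factor A hApos
    rw [Matrix.isUnit_iff_isUnit_det] at hB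
    have hB' : IsUnit (Bᵀ).det := by rwa [Matrix.det_transpose]
    refine ⟨(Bᵀ)⁻¹, ?_, ?_⟩
    · rw [hBA, Matrix.conjTranspose_eq_transpose_of_trivial, ← Matrix.mul_assoc,
        Matrix.nonsing_inv_mul _ hB', Matrix.one_mul, Matrix.transpose_nonsing_inv,
        Matrix.transpose_transpose, Matrix.mul_nonsing_inv _ hB]
    · rw [Matrix.det_nonsing_inv]; exact (IsUnit.ringInverse hB')
  obtain ⟨K, hK⟩ : ∃ K, K = C * symplForm (2 * N) * Cᵀ := ⟨_, rfl⟩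
  have hKt : Kᵀ = -K := by
    rw [hK, Matrix.transpose_mul, Matrix.transpose_mul, sympl_transpose]
    simp [Matrix.mul_assoc]
  have hKinj : ∀ v, K *ᵥ v = 0 → v = 0 := by
    intro v hv
    have hC' : IsUnit (Cᵀ).det := by rwa [Matrix.det_transpose]
    rw [hK, ← Matrix.mulVec_mulVec, ← Matrix.mulVec_mulVec] at hv
    have i1 := Matrix.mulVec_injective_of_isUnit ((Matrix.isUnit_iff_isUnit_det _).2 hC)
    have i2 := Matrix.mulVec_injective_of_isUnit ((Matrix.isUnit_iff_isUnit_det _).2 hC')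
    have h1 := sympl_inj N _ (i1 (hv.trans (Matrix.mulVec_zero _).symm))
    exact i2 (h1.trans (Matrix.mulVec_zero _).symm)
  have hin : ∀ x y : EuclideanSpace ℝ (Fin (2 * N)), inner ℝ x y = x.ofLp ⬝ᵥ y.ofLp := by
    intro x y
    rw [EuclideanSpace.inner_eq_star_dotProduct, dotProduct_comm]
    simp
  obtain ⟨d, e, f, hd, h1, h2, h3, h4, h5⟩ := skew_normal N (EuclideanSpace ℝ (Fin (2 * N)))
    (Matrix.toLpLin 2 2 K) (by simp) (by
      intro x y
      rw [hin, hin, Matrix.ofLp_toLpLin, Matrix.ofLp_toLpLin, Matrix.toLin'_apply,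
        Matrix.toLin'_apply, Matrix.dotProduct_mulVec, ← Matrix.mulVec_transpose, hKt,
        Matrix.neg_mulVec, neg_dotProduct, neg_neg]) (by
      intro x hx
      have := hKinj x.ofLp (congrArg WithLp.ofLp hx)
      exact (WithLp.ofLp_eq_zero 2).1 this)
  have h4' : ∀ i, K *ᵥ (e i).ofLp = - d i • (f i).ofLp := fun i => congrArg WithLp.ofLp (h4 i)
  have h5' : ∀ i, K *ᵥ (f i).ofLp = d i • (e i).ofLp := fun i => congrArg WithLp.ofLp (h5 i)
  have h3' : ∀ i j, (f i).ofLp ⬝ᵥ (e j).ofLp = 0 := fun i j => by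
    rw [dotProduct_comm, ← hin, h3]
  simp only [hin] at h1 h2 h3
  let idx : Fin (2 * N) → Fin N := fun i => ⟨(i : ℕ) / 2, by have := i.isLt; omega⟩
  let o : Fin (2 * N) → Fin (2 * N) → ℝ := fun i =>
    if (i : ℕ) % 2 = 0 then (e (idx i)).ofLp else (f (idx i)).ofLp
  let s : Fin (2 * N) → ℝ := fun i => (Real.sqrt (d (idx i)))⁻¹
  have hs : ∀ i j, idx i = idx j → s i * s j = (d (idx i))⁻¹ := by
    intro i j hij
    simp only [s, ← hij]
    rw [← mul_inv, Real.mul_self_sqrt (hd _).le]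
  have key : ∀ (M : Matrix (Fin (2 * N)) (Fin (2 * N)) ℝ) i j,
      ((Matrix.diagonal s * Matrix.of o) * M * (Matrix.diagonal s * Matrix.of o)ᵀ) i j
        = s i * s j * (o i ⬝ᵥ M *ᵥ o j) := by
    intro M i j
    rw [Matrix.transpose_mul, Matrix.diagonal_transpose, ← Matrix.mul_assoc,
      Matrix.mul_diagonal, Matrix.mul_assoc, Matrix.mul_assoc, Matrix.diagonal_mul]
    have : (Matrix.of o * (M * (Matrix.of o)ᵀ)) i j = o i ⬝ᵥ M *ᵥ o j := rfl
    rw [this]; ring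
  have hoo : ∀ i j, o i ⬝ᵥ o j = if i = j then 1 else 0 := by
    intro i j
    have hij : i = j ↔ (idx i = idx j ∧ (i : ℕ) % 2 = (j : ℕ) % 2) := by
      simp only [idx, Fin.ext_iff]; omega
    rcases Nat.mod_two_eq_zero_or_one i with hi | hi <;>
    rcases Nat.mod_two_eq_zero_or_one j with hj | hj <;>
    simp [o, hij, hi, hj, h1, h2, h3, h3']
  have hoK : ∀ i j, o i ⬝ᵥ K *ᵥ o j = d (idx i) * symplForm (2 * N) i j := by
    intro i j
    have e1 : ((i : ℕ) + 1 = j ∧ (i : ℕ) % 2 = 0) ↔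
      (idx i = idx j ∧ (i : ℕ) % 2 = 0 ∧ (j : ℕ) % 2 = 1) := by
      simp only [idx, Fin.ext_iff]; omega
    have e2 : ((j : ℕ) + 1 = i ∧ (j : ℕ) % 2 = 0) ↔
      (idx i = idx j ∧ (i : ℕ) % 2 = 1 ∧ (j : ℕ) % 2 = 0) := by
      simp only [idx, Fin.ext_iff]; omega
    simp only [symplForm, Matrix.of_apply, e1, e2]
    rcases Nat.mod_two_eq_zero_or_one i with hi | hi <;>
    rcases Nat.mod_two_eq_zero_or_one j with hj | hj <;>
    by_cases hij : idx i = idx j <;>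
    simp [o, hij, hi, hj, h1, h2, h3, h3', h4', h5']
  refine ⟨(Matrix.diagonal s * Matrix.of o) * C, fun i => (d i)⁻¹, ?_,
    fun i => inv_pos.2 (hd i), ?_⟩
  · have : (Matrix.diagonal s * Matrix.of o) * C * symplForm (2 * N) *
        ((Matrix.diagonal s * Matrix.of o) * C)ᵀ
        = (Matrix.diagonal s * Matrix.of o) * K * (Matrix.diagonal s * Matrix.of o)ᵀ := by
      rw [hK, Matrix.transpose_mul (Matrix.diagonal s * Matrix.of o) C]
      simp only [Matrix.mul_assoc]
    unfold IsSymplectic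
    rw [this]
    ext i j
    rw [key, hoK]
    by_cases hij : idx i = idx j
    · rw [hs i j hij, ← mul_assoc, inv_mul_cancel₀ (hd _).ne', one_mul]
    · have : symplForm (2 * N) i j = 0 := by
        simp only [idx, Fin.ext_iff] at hij
        simp only [symplForm, Matrix.of_apply]
        rw [if_neg (by omega), if_neg (by omega)]
      rw [this]; simp
  · have : (Matrix.diagonal s * Matrix.of o) * C * A *
        ((Matrix.diagonal s * Matrix.of o) * C)ᵀ
        = (Matrix.diagonal s * Matrix.of o) * 1 * (Matrix.diagonal s * Matrix.of o)ᵀ := by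
      rw [← hCA, Matrix.transpose_mul (Matrix.diagonal s * Matrix.of o) C]
      simp only [Matrix.mul_assoc]
    rw [this]
    ext i j
    rw [key, Matrix.one_mulVec, hoo]
    unfold WDiag
    by_cases hij : i = j
    · subst hij
      rw [hs i i rfl]; simp [idx]
    · simp [hij]
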